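/- Let I be a prime ideal in K[x_1, ..., x_n] and for 1 ≤ k ≤ n let I_k = I ∩ K[x_1, ..., x_k]. Then deg(I_k) ≤ deg(I), where deg denotes the degree of the projective closure of the affine variety defined by the ideal. -/

import Mathlib

open MvPolynomial

/-- The degree of (the projective closure of) the affine variety of an ideal
`I ⊆ K[x₁,…,x_ν]`, via the Heintz characterization: the maximal finite number of points
in an intersection of `V(I)` with an affine linear subspace. -/
noncomputable def affineDegree {K : Type*} [Field K] {ν : ℕ}
    (I : Ideal (MvPolynomial (Fin ν) K)) : ℕ :=
  sSup {c : ℕ | ∃ L : Finset (MvPolynomial (Fin ν) K),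
    (∀ f ∈ L, f.totalDegree ≤ 1) ∧
    {x : Fin ν → K | (∀ f ∈ I, eval x f = 0) ∧ ∀ f ∈ L, eval x f = 0}.Finite ∧
    {x : Fin ν → K | (∀ f ∈ I, eval x f = 0) ∧ ∀ f ∈ L, eval x f = 0}.ncard = c}

theorem ext_hom {A R K : Type*} [CommRing A] [CommRing R] [Algebra A R] [Algebra.IsIntegral A R]
    [Field K] [IsAlgClosed K] (hinj : Function.Injective (algebraMap A R)) (φ : A →+* K) :
    ∃ ψ : R →+* K, ∀ a, ψ (algebraMap A R a) = φ a := by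
  have hP : (RingHom.ker φ).IsPrime := RingHom.ker_isPrime φ
  obtain ⟨Q, -, hQ, hQP⟩ := Ideal.exists_ideal_over_prime_of_isIntegral (S := R) (RingHom.ker φ) ⊥
    (by
      intro x hx
      rw [Ideal.mem_comap, Ideal.mem_bot] at hx
      rw [(injective_iff_map_eq_zero _).1 hinj x hx]; simp)
  have : Q.LiesOver (RingHom.ker φ) := ⟨hQP.symm⟩
  let P := RingHom.ker φ
  let ι : A ⧸ P →+* K := RingHom.kerLift φ
  let := ι.toAlgebra
  have h1 : Function.Injective (algebraMap (A ⧸ P) K) := RingHom.kerLift_injective φ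
  have h2 : Function.Injective (algebraMap (A ⧸ P) (R ⧸ Q)) := FaithfulSMul.algebraMap_injective _ _
  have : FaithfulSMul (A ⧸ P) K := (faithfulSMul_iff_algebraMap_injective _ _).2 h1
  have : Module.IsTorsionFree (A ⧸ P) K := inferInstance
  have : Module.IsTorsionFree (A ⧸ P) (R ⧸ Q) :=
    (Module.isTorsionFree_iff_algebraMap_injective).2 h2
  have : Algebra.IsIntegral (A ⧸ P) (R ⧸ Q) := inferInstance
  have : Algebra.IsAlgebraic (A ⧸ P) (R ⧸ Q) := inferInstance
  let L : R ⧸ Q →ₐ[A ⧸ P] K := IsAlgClosed.lift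
  refine ⟨L.toRingHom.comp (Ideal.Quotient.mk Q), fun a => ?_⟩
  have : (Ideal.Quotient.mk Q) (algebraMap A R a) = algebraMap (A ⧸ P) (R ⧸ Q) (Ideal.Quotient.mk P a) := rfl
  simp only [RingHom.comp_apply, this]
  exact L.commutes _

theorem lin_prod {ι R : Type*} [CommRing R] (g a : ι → R) (e : ι → ℕ) (s : Finset ι) :
    (∏ i ∈ s, (Polynomial.C (g i) + Polynomial.C (a i) * Polynomial.X) ^ e i).natDegree
      ≤ ∑ i ∈ s, e i ∧
    (∏ i ∈ s, (Polynomial.C (g i) + Polynomial.C (a i) * Polynomial.X) ^ e i).coeff (∑ i ∈ s, e i)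
      = ∏ i ∈ s, a i ^ e i := by
  classical
  have h0 : ∀ i, (Polynomial.C (g i) + Polynomial.C (a i) * Polynomial.X).natDegree ≤ 1 := by
    intro i; compute_degree
  induction s using Finset.induction_on with
  | empty => simp
  | insert i s hi ih =>
    rw [Finset.prod_insert hi, Finset.sum_insert hi, Finset.prod_insert hi]
    have h1 : ((Polynomial.C (g i) + Polynomial.C (a i) * Polynomial.X) ^ e i).natDegree ≤ e i := by
      refine Polynomial.natDegree_pow_le.trans ?_
      simpa using Nat.mul_le_mul_left (e i) (h0 i)
    have h2 : ((Polynomial.C (g i) + Polynomial.C (a i) * Polynomial.X) ^ e i).coeff (e i)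
        = a i ^ e i := by
      have := Polynomial.coeff_pow_of_natDegree_le (m := e i) (h0 i)
      rw [mul_one] at this
      rw [this]; simp
    refine ⟨Polynomial.natDegree_mul_le.trans (add_le_add h1 ih.1), ?_⟩
    rw [Polynomial.coeff_mul_add_eq_of_natDegree_le h1 ih.1, h2, ih.2]

theorem lin_int {N : ℕ} {K B : Type*} [Field K] [CommRing B] [Algebra K B]
    (P : MvPolynomial (Fin N) K) (a : Fin N → K)
    (ha : eval a (homogeneousComponent P.totalDegree P) ≠ 0)
    (g : Fin N → B) (w : B) {R : Type*} [CommRing R] [Algebra R B] [Algebra K R]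
    [IsScalarTower K R B]
    (g' : Fin N → R) (hg : ∀ i, algebraMap R B (g' i) = g i)
    (hw : aeval (fun i => g i + algebraMap K B (a i) * w) P = 0) : IsIntegral R w := by
  classical
  set a' : Fin N → R := fun i => algebraMap K R (a i) with ha'
  set v : Fin N → Polynomial R := fun i =>
    Polynomial.C (g' i) + Polynomial.C (a' i) * Polynomial.X with hv
  set D := P.totalDegree
  let Q : Polynomial R := aeval v P
  have hQ : Q = ∑ m ∈ P.support, Polynomial.C (algebraMap K R (P.coeff m)) *
      ∏ i, (v i) ^ (m i) := by
    simp only [Q, aeval_def, eval₂_eq']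
    rfl
  have hdeg : ∀ m ∈ P.support, ∑ i, m i ≤ D := by
    intro m hm
    have := le_totalDegree hm
    rwa [Finsupp.sum_fintype _ _ (by simp)] at this
  have hQd : Q.natDegree ≤ D := by
    rw [hQ]
    refine Polynomial.natDegree_sum_le_of_forall_le _ _ fun m hm => ?_
    refine (Polynomial.natDegree_C_mul_le _ _).trans ?_
    exact (lin_prod g' a' m Finset.univ).1.trans (hdeg m hm)
  have hQc : Q.coeff D = algebraMap K R (eval a (homogeneousComponent D P)) := by
    rw [hQ, Polynomial.finsetSum_coeff, homogeneousComponent_apply, map_sum, map_sum,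
      Finset.sum_filter]
    refine Finset.sum_congr rfl fun m hm => ?_
    rw [Polynomial.coeff_C_mul]
    have hmd : m.degree = ∑ i, m i := by
      rw [Finsupp.degree_eq_sum]
    split_ifs with h
    · have := (lin_prod g' a' m Finset.univ).2
      rw [← hmd, h] at this
      rw [this, eval_monomial, Finsupp.prod_fintype _ _ (by simp)]
      simp [ha']
    · rw [Polynomial.coeff_eq_zero_of_natDegree_lt, mul_zero]
      refine lt_of_le_of_lt (lin_prod g' a' m Finset.univ).1 ?_
      exact lt_of_le_of_ne (hdeg m hm) (by rw [← hmd]; exact h)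
  set c := eval a (homogeneousComponent D P)
  have hQw : Polynomial.aeval w Q = 0 := by
    rw [← hw]
    have : (Polynomial.aeval w : Polynomial R →ₐ[R] B) (aeval v P) =
      ((Polynomial.aeval w : Polynomial R →ₐ[R] B).restrictScalars K) (aeval v P) := rfl
    simp only [Q]
    rw [this, ← AlgHom.comp_apply]
    congr 1
    ext i
    simp [hv, ha', hg, ← IsScalarTower.algebraMap_apply]
  refine ⟨Polynomial.C (algebraMap K R c⁻¹) * Q, ?_, ?_⟩
  · refine Polynomial.monic_of_natDegree_le_of_coeff_eq_one D ?_ ?_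
    · exact (Polynomial.natDegree_C_mul_le _ _).trans hQd
    · rw [Polynomial.coeff_C_mul, hQc, ← map_mul, inv_mul_cancel₀ ha, map_one]
  · rw [← Polynomial.aeval_def, map_mul, hQw, mul_zero]

theorem lin_noether {K B : Type*} [Field K] [Infinite K] [CommRing B] [Nontrivial B] [Algebra K B]
    (N : ℕ) (f : Fin N → B) : ∃ (d : ℕ) (l : Fin d → B),
      (∀ i, l i ∈ Submodule.span K (Set.range f)) ∧ AlgebraicIndependent K l ∧
      ∀ i, IsIntegral (Algebra.adjoin K (Set.range l)) (f i) := by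
  induction N with
  | zero =>
    refine ⟨0, f, fun i => i.elim0, ?_, fun i => i.elim0⟩
    exact (algebraicIndependent_empty_type_iff ..).2 (algebraMap K B).injective
  | succ N ih =>
    by_cases hf : AlgebraicIndependent K f
    · refine ⟨N + 1, f, fun i => Submodule.subset_span ⟨i, rfl⟩, hf, fun i => ?_⟩
      exact isIntegral_algebraMap (x := (⟨f i, Algebra.subset_adjoin ⟨i, rfl⟩⟩ :
        Algebra.adjoin K (Set.range f)))
    rw [algebraicIndependent_iff] at hf
    push Not at hf
    obtain ⟨P, hP, hP0⟩ := hf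
    have hD : P.totalDegree ≠ 0 := by
      intro h
      rw [totalDegree_eq_zero_iff_eq_C] at h
      rw [h, aeval_C, ← map_zero (algebraMap K B)] at hP
      have := (algebraMap K B).injective hP
      rw [this, C_0] at h
      exact hP0 h
    have hH : homogeneousComponent P.totalDegree P ≠ 0 := by
      classical
      intro h
      have hs : P.support.Nonempty := by simpa using hP0
      obtain ⟨m, hm, hm'⟩ := Finset.exists_mem_eq_sup _ hs (fun s => s.sum fun _ e => e)
      have := congrArg (coeff m) h
      rw [coeff_homogeneousComponent, if_pos, coeff_zero] at this
      · exact (mem_support_iff.1 hm) this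
      · rw [Finsupp.degree_eq_sum, totalDegree, hm', Finsupp.sum_fintype _ _ (by simp)]
    obtain ⟨a, ha⟩ : ∃ a, eval a (homogeneousComponent P.totalDegree P) ≠ 0 := by
      by_contra! h
      exact hH (MvPolynomial.funext (by simpa using h))
    obtain ⟨j, hj⟩ : ∃ j, a j ≠ 0 := by
      by_contra! h
      apply ha
      have ha0 : a = 0 := funext h
      have hh := homogeneousComponent_isHomogeneous P.totalDegree P
      rw [ha0, MvPolynomial.eval_zero, constantCoeff_eq]
      exact hh.coeff_eq_zero (by simpa using hD.symm)
    set w : B := algebraMap K B (a j)⁻¹ * f j with hw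
    set g : Fin (N + 1) → B := fun i => f i - algebraMap K B (a i) * w with hg
    have hgj : g j = 0 := by
      simp only [hg, hw, ← mul_assoc, ← map_mul, mul_inv_cancel₀ hj, map_one, one_mul, sub_self]
    obtain ⟨d, l, hl, hli, hint⟩ := ih (fun i => g (j.succAbove i))
    refine ⟨d, l, fun i => ?_, hli, ?_⟩
    · refine Submodule.span_le.2 ?_ (hl i)
      rintro _ ⟨i, rfl⟩
      refine Submodule.sub_mem _ (Submodule.subset_span ⟨_, rfl⟩) ?_
      rw [hw, ← mul_assoc, ← map_mul, ← Algebra.smul_def]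
      exact Submodule.smul_mem _ _ (Submodule.subset_span ⟨_, rfl⟩)
    · have hgi : ∀ i, IsIntegral (Algebra.adjoin K (Set.range l)) (g i) := by
        intro i
        rcases Fin.eq_self_or_eq_succAbove j i with rfl | ⟨i, rfl⟩
        · rw [hgj]; exact isIntegral_zero
        · exact hint i
      have hwi : IsIntegral (integralClosure (Algebra.adjoin K (Set.range l)) B) w := by
        refine lin_int P a ha g w (fun i => ⟨g i, hgi i⟩) (fun i => rfl) ?_
        rw [← hP]
        congr 2
        ext i
        simp [hg]
      have hwi' : IsIntegral (Algebra.adjoin K (Set.range l)) w := isIntegral_trans _ hwi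
      intro i
      have : f i = g i + algebraMap K B (a i) * w := by simp [hg]
      rw [this]
      refine (hgi i).add (IsIntegral.mul ?_ hwi')
      rw [IsScalarTower.algebraMap_apply K (Algebra.adjoin K (Set.range l)) B]
      exact isIntegral_algebraMap

theorem null_max {K B : Type*} [Field K] [IsAlgClosed K] [CommRing B] [Algebra K B]
    [Algebra.FiniteType K B] (M : Ideal B) (hM : M.IsMaximal) :
    ∃ p : B →ₐ[K] K, RingHom.ker p = M := by
  let := Ideal.Quotient.field M
  have h1 : Module.Finite K (B ⧸ M) := finite_of_finite_type_of_isJacobsonRing K (B ⧸ M)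
  have h2 : Function.Bijective (algebraMap K (B ⧸ M)) :=
    IsAlgClosed.algebraMap_bijective_of_isIntegral
  let e : K ≃ₐ[K] (B ⧸ M) := AlgEquiv.ofBijective (Algebra.ofId K (B ⧸ M)) h2
  refine ⟨(e.symm : (B ⧸ M) →ₐ[K] K).comp (Ideal.Quotient.mkₐ K M), ?_⟩
  ext x
  rw [RingHom.mem_ker]
  simp [Ideal.Quotient.eq_zero_iff_mem]

theorem ker_max {K B : Type*} [Field K] [CommRing B] [Algebra K B] (p : B →ₐ[K] K) :
    (RingHom.ker p).IsMaximal :=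
  RingHom.ker_isMaximal_of_surjective p (fun x => ⟨algebraMap K B x, by simp⟩)

theorem hom_eq_of_ker_le {K B : Type*} [Field K] [CommRing B] [Algebra K B] (p q : B →ₐ[K] K)
    (h : RingHom.ker p ≤ RingHom.ker q) : p = q := by
  ext x
  have : x - algebraMap K B (p x) ∈ RingHom.ker p := by simp [RingHom.mem_ker]
  have := h this
  rw [RingHom.mem_ker, map_sub, AlgHom.commutes, sub_eq_zero] at this
  exact this.symm

theorem fiber_prime {K B : Type*} [Field K] [IsAlgClosed K] [CommRing B] [Algebra K B]
    [Algebra.FiniteType K B] (F : Set B) (hfin : {p : B →ₐ[K] K | ∀ b ∈ F, p b = 0}.Finite)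
    (Q : Ideal B) (hQ : Q.IsPrime) (hF : F ⊆ Q) :
    ∃ p : B →ₐ[K] K, (∀ b ∈ F, p b = 0) ∧ Q = RingHom.ker p := by
  classical
  have hJ : IsJacobsonRing B := isJacobsonRing_of_finiteType (A := K)
  have key : hfin.toFinset.inf (fun p => RingHom.ker p) ≤ Q := by
    intro x hx
    rw [← hQ.radical, Ideal.radical_eq_jacobson, Ideal.jacobson, Submodule.mem_sInf]
    rintro M ⟨hQM, hM⟩
    obtain ⟨p, rfl⟩ := null_max (K := K) M hM
    rw [Submodule.mem_finsetInf] at hx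
    exact hx p (by simpa using fun b hb => hQM (hF hb))
  obtain ⟨p, hp, hpQ⟩ := (hQ.inf_le').1 key
  refine ⟨p, by simpa using hp, ?_⟩
  exact ((ker_max p).eq_of_le hQ.ne_top hpQ).symm

theorem key_B {K B : Type*} [Field K] [IsAlgClosed K] [CommRing B] [IsDomain B] [Algebra K B]
    [Algebra.FiniteType K B] {N : ℕ} (f : Fin N → B)
    (hfin : {p : B →ₐ[K] K | ∀ i, p (f i) = 0}.Finite)
    (hne : {p : B →ₐ[K] K | ∀ i, p (f i) = 0}.Nonempty) :
    ∃ (d : ℕ) (l : Fin d → B), (∀ i, l i ∈ Submodule.span K (Set.range f)) ∧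
      IsTranscendenceBasis K l ∧
      ∃ u : B, IsIntegral (Algebra.adjoin K (Set.range l)) u ∧
        Set.InjOn (fun p : B →ₐ[K] K => p u) {p : B →ₐ[K] K | ∀ i, p (f i) = 0} := by
  classical
  set S := {p : B →ₐ[K] K | ∀ i, p (f i) = 0} with hS
  have hK : Infinite K := IsAlgClosed.instInfinite
  obtain ⟨d, l, hl, hli, hint⟩ := lin_noether (K := K) N f
  let A := Algebra.adjoin K (Set.range l)
  let A' := Algebra.adjoin K (Set.range f)
  have hftype : Algebra.FiniteType A' B := Algebra.FiniteType.of_restrictScalars_finiteType K A' B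
  have hAA : ∀ x : A', IsIntegral A (x : B) := by
    rintro ⟨x, hx⟩
    induction hx using Algebra.adjoin_induction with
    | mem x hx => obtain ⟨i, rfl⟩ := hx; exact hint i
    | algebraMap r => exact (isIntegral_algebraMap (x := algebraMap K A r))
    | add x y _ _ hx hy => exact hx.add hy
    | mul x y _ _ hx hy => exact hx.mul hy
  have htrans : ∀ x : B, IsIntegral A' x → IsIntegral A x := by
    intro x hx
    let g : A' →+* integralClosure A B :=
      (algebraMap A' B).codRestrict (integralClosure A B) hAA
    obtain ⟨P, hP, hPx⟩ := hx
    have h2 : IsIntegral (integralClosure A B) x := by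
      refine ⟨P.map g, hP.map _, ?_⟩
      rw [Polynomial.eval₂_map]
      exact hPx
    exact isIntegral_trans _ h2
  have hz : ∀ p ∈ S, ∃ r : B, p r ≠ 0 ∧ IsIntegral A r ∧ ∀ x, ∃ m : ℕ, IsIntegral A (r ^ m * x) := by
    intro p hp
    have hpmax := ker_max p
    let q : PrimeSpectrum B := ⟨RingHom.ker p, hpmax.isPrime⟩
    obtain ⟨s, hs, hs'⟩ : ∃ s : B, s ∉ RingHom.ker p ∧ ∀ p' ∈ S, p' ≠ p → p' s = 0 := by
      have : ¬ ((hfin.toFinset.erase p).inf (fun p => RingHom.ker p) ≤ RingHom.ker p) := by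
        intro h
        obtain ⟨p', hp', h'⟩ := (hpmax.isPrime.inf_le').1 h
        have := hom_eq_of_ker_le _ _ h'
        simp [this] at hp'
      obtain ⟨s, hs, hs'⟩ := SetLike.not_le_iff_exists.1 this
      refine ⟨s, hs', fun p' hp' hne' => ?_⟩
      rw [Submodule.mem_finsetInf] at hs
      exact hs p' (by simp [hne']; exact hp')
    have hopen : Algebra.QuasiFiniteAt A' q.asIdeal := by
      apply Algebra.QuasiFiniteAt.of_isOpen_singleton_fiber
      refine isOpen_induced_iff.2 ⟨PrimeSpectrum.basicOpen s, PrimeSpectrum.isOpen_basicOpen, ?_⟩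
      ext ⟨q', hq'⟩
      simp only [Set.mem_preimage, SetLike.mem_coe, PrimeSpectrum.mem_basicOpen,
        Set.mem_singleton_iff, Subtype.mk.injEq]
      constructor
      · intro hsq
        have hsub : ∀ b ∈ Set.range f, b ∈ q'.asIdeal := by
          rintro _ ⟨i, rfl⟩
          have h1 : (⟨f i, Algebra.subset_adjoin ⟨i, rfl⟩⟩ : A') ∈
              (PrimeSpectrum.comap (algebraMap A' B) q).asIdeal := by
            change f i ∈ RingHom.ker p
            exact hp i
          rw [← hq'] at h1
          exact h1
        obtain ⟨p', hp', h'⟩ := fiber_prime (K := K) (Set.range f) (by simpa using hfin)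
          q'.asIdeal q'.isPrime hsub
        have : p' = p := by
          by_contra hne'
          apply hsq
          rw [h']
          exact hs' p' (fun i => hp' _ ⟨i, rfl⟩) hne'
        exact Subtype.ext (PrimeSpectrum.ext (by rw [h', this]))
      · intro h
        have h1 : q' = q := congrArg Subtype.val h
        rw [h1]
        exact hs
    have hZ := Algebra.ZariskisMainProperty.of_finiteType (R := A') q.asIdeal
    obtain ⟨r, hr, hri, hrx⟩ := Algebra.zariskisMainProperty_iff.1 hZ
    exact ⟨r, hr, htrans _ hri, fun x => (hrx x).imp fun m hm => htrans _ hm⟩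
  refine ⟨d, l, hl, ?_, ?_⟩
  · rw [hli.isTranscendenceBasis_iff_isAlgebraic]
    obtain ⟨p, hp⟩ := hne
    obtain ⟨r, hr, hri, hrx⟩ := hz p hp
    have hr0 : r ≠ 0 := by rintro rfl; simp at hr
    refine ⟨fun x => ?_⟩
    obtain ⟨m, hm⟩ := hrx x
    have h1 : IsAlgebraic A (r ^ m * x) := hm.isAlgebraic
    have h2 : IsAlgebraic A (r ^ m) := (hri.pow m).isAlgebraic
    exact IsAlgebraic.of_mul (mem_nonZeroDivisors_of_ne_zero (pow_ne_zero m hr0)) h2 h1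
  · let D := (integralClosure A B).restrictScalars K
    have := hfin.to_subtype
    by_contra! hcon
    let T : {x : S × S // x.1 ≠ x.2} → Subspace K D := fun x =>
      LinearMap.ker ((x.1.1.1.toLinearMap - x.1.2.1.toLinearMap).comp D.val.toLinearMap)
    have hcov : ⋃ i, (T i : Set D) = Set.univ := by
      rw [Set.eq_univ_iff_forall]
      rintro ⟨u, hu⟩
      have := hcon u hu
      simp only [Set.InjOn, not_forall] at this
      obtain ⟨p, hp, q, hq, hpq, hne'⟩ := this
      rw [Set.mem_iUnion]
      refine ⟨⟨(⟨p, hp⟩, ⟨q, hq⟩), by simpa using hne'⟩, ?_⟩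
      simp [T, sub_eq_zero]
      exact hpq
    obtain ⟨⟨⟨⟨p, hp⟩, ⟨q, hq⟩⟩, hpq⟩, hT⟩ := Subspace.exists_eq_top_of_iUnion_eq_univ hcov
    have hT' : ∀ x : B, IsIntegral A x → p x = q x := by
      intro x hx
      have : (⟨x, hx⟩ : D) ∈ T ⟨(⟨p, hp⟩, ⟨q, hq⟩), hpq⟩ := by rw [hT]; trivial
      simpa [T, sub_eq_zero] using this
    apply hpq
    simp only [Subtype.mk.injEq]
    obtain ⟨r, hr, hri, hrx⟩ := hz p hp
    ext x
    obtain ⟨m, hm⟩ := hrx x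
    have := hT' _ hm
    rw [map_mul, map_mul, map_pow, map_pow, ← hT' r hri] at this
    exact mul_left_cancel₀ (pow_ne_zero _ hr) this

theorem lem_C {A C Ω K : Type*} [CommRing A] [IsDomain A] [IsIntegrallyClosed A]
    [CommRing C] [IsDomain C] [Algebra A C] [FaithfulSMul A C] [Algebra.IsAlgebraic A C]
    [Field Ω] [IsAlgClosed Ω] [Algebra A Ω] [FaithfulSMul A Ω]
    [Field K] [IsAlgClosed K] (ψ0 : A →+* K) (u : C) (hu : IsIntegral A u) :
    ∃ σ : {v : K // Polynomial.eval₂ ψ0 v (minpoly A u) = 0} → (C →ₐ[A] Ω),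
      Function.Injective (fun v => σ v u) := by
  classical
  have hAC : FaithfulSMul A (FractionRing C) := inferInstance
  let := FractionRing.liftAlgebra A (FractionRing C)
  let := FractionRing.liftAlgebra A Ω
  have i1 := FractionRing.isScalarTower_liftAlgebra A (FractionRing C)
  have i2 := FractionRing.isScalarTower_liftAlgebra A Ω
  have halg : Algebra.IsAlgebraic A (FractionRing C) :=
    (IsFractionRing.isAlgebraic_iff' A C (FractionRing C)).1 inferInstance
  have halg' : Algebra.IsAlgebraic (FractionRing A) (FractionRing C) :=
    IsFractionRing.comap_isAlgebraic_iff.1 halg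
  set F := minpoly A u with hF
  have hFm : F.Monic := minpoly.monic hu
  let R := integralClosure A Ω
  have hinj : Function.Injective (algebraMap A R) := by
    have := FaithfulSMul.algebraMap_injective A Ω
    rw [IsScalarTower.algebraMap_eq A R Ω, RingHom.coe_comp] at this
    exact Function.Injective.of_comp this
  obtain ⟨ψ, hψ⟩ := ext_hom (R := R) hinj ψ0
  obtain ⟨m, hm⟩ := Polynomial.splits_iff_exists_multiset.1
    (IsAlgClosed.splits (F.map (algebraMap A Ω)))
  rw [(hFm.map _).leadingCoeff, map_one, one_mul] at hm
  have hroot : ∀ α ∈ m, Polynomial.aeval α F = 0 := by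
    intro α hα
    rw [← Polynomial.eval_map_algebraMap, hm, Polynomial.eval_multiset_prod]
    apply Multiset.prod_eq_zero
    rw [Multiset.map_map, Multiset.mem_map]
    exact ⟨α, hα, by simp⟩
  have hintm : ∀ α ∈ m, α ∈ R := fun α hα => ⟨F, hFm, hroot α hα⟩
  let m' : Multiset R := m.attach.map (fun α => ⟨α.1, hintm _ α.2⟩)
  have hm' : F.map (algebraMap A R) =
      (m'.map (fun x => Polynomial.X - Polynomial.C x)).prod := by
    apply Polynomial.map_injective (algebraMap R Ω) Subtype.val_injective
    rw [Polynomial.map_map, ← IsScalarTower.algebraMap_eq A R Ω, hm, Polynomial.map_multiset_prod]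
    rw [Multiset.map_map, Multiset.map_map]
    conv_lhs => rw [← Multiset.attach_map_val m, Multiset.map_map]
    congr 1
    apply Multiset.map_congr rfl
    intro x _
    simp
  have hv : ∀ v : {v : K // Polynomial.eval₂ ψ0 v F = 0}, ∃ α ∈ m', ψ α = v := by
    rintro ⟨v, hv⟩
    have h1 : ψ0 = ψ.comp (algebraMap A R) := by ext a; simp [hψ]
    rw [h1, ← Polynomial.eval₂_map, hm', ← Polynomial.eval_map, Polynomial.map_multiset_prod,
      Polynomial.eval_multiset_prod, Multiset.map_map, Multiset.map_map,
      Multiset.prod_eq_zero_iff, Multiset.mem_map] at hv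
    obtain ⟨α, hα, h⟩ := hv
    refine ⟨α, hα, ?_⟩
    simp [sub_eq_zero] at h
    exact h.symm
  choose α hα hαv using hv
  have hex : ∀ v, ∃ σ : C →ₐ[A] Ω, σ u = α v := by
    intro v
    obtain ⟨φ, hφ⟩ := IntermediateField.exists_algHom_of_splits_of_aeval
      (F := FractionRing A) (E := FractionRing C) (K := Ω)
      (fun s => ⟨(halg'.isAlgebraic s).isIntegral, IsAlgClosed.splits _⟩)
      (x := algebraMap C _ u) (y := (α v : Ω)) (by
        rw [minpoly.isIntegrallyClosed_eq_field_fractions (FractionRing A) (FractionRing C) hu,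
          Polynomial.aeval_map_algebraMap]
        have := hα v
        rw [Multiset.mem_map] at this
        obtain ⟨a, -, ha⟩ := this
        rw [← ha]
        exact hroot _ a.2)
    exact ⟨(φ.restrictScalars A).comp (IsScalarTower.toAlgHom A C (FractionRing C)), hφ⟩
  choose σ hσ using hex
  refine ⟨σ, fun v w h => ?_⟩
  simp only [hσ] at h
  have := Subtype.ext h
  apply Subtype.ext
  rw [← hαv, ← hαv, this]

theorem lem_D {K A C Ω J : Type*} [Field K] [IsAlgClosed K] [CommRing A] [IsDomain A] [Algebra K A]
    (hA : ∀ t : A, t ≠ 0 → ∃ φ : A →ₐ[K] K, φ t ≠ 0)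
    [CommRing C] [IsDomain C] [Algebra K C] [Algebra A C] [IsScalarTower K A C]
    [Algebra.IsAlgebraic A C]
    [Field Ω] [Algebra A Ω] [FaithfulSMul A Ω] [Algebra.IsAlgebraic A Ω]
    {n : ℕ} (x : Fin n → C) (hx : Algebra.adjoin K (Set.range x) = ⊤) (u : C)
    [Finite J] (σ : J → (C →ₐ[A] Ω)) (hσ : Function.Injective (fun j => σ j u)) :
    ∃ φ : A →ₐ[K] K, {τ : C →ₐ[K] K | ∀ a, τ (algebraMap A C a) = φ a}.Finite ∧
      Nat.card J ≤ {τ : C →ₐ[K] K | ∀ a, τ (algebraMap A C a) = φ a}.ncard := by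
  classical
  have := Fintype.ofFinite J
  obtain ⟨t1, ht1, h1⟩ := Algebra.IsAlgebraic.exists_integral_multiples A
    ((Finset.univ.image (fun p : J × Fin n => σ p.1 (x p.2))) ∪
      (Finset.univ.image (fun p : J × J => (σ p.1 u - σ p.2 u)⁻¹)))
  obtain ⟨t2, ht2, h2⟩ := Algebra.IsAlgebraic.exists_integral_multiples A
    (Finset.univ.image x)
  obtain ⟨φ, hφ⟩ := hA (t1 * t2) (mul_ne_zero ht1 ht2)
  rw [map_mul] at hφ
  have hφ1 := left_ne_zero_of_mul hφ
  have hφ2 := right_ne_zero_of_mul hφ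
  have hfin : {τ : C →ₐ[K] K | ∀ a, τ (algebraMap A C a) = φ a}.Finite := by
    have h3 : ∀ i, IsIntegral A (t2 • x i) := fun i => h2 _ (by simp)
    choose P hP hPx using h3
    let f : (C →ₐ[K] K) → (Fin n → K) := fun τ i => τ (t2 • x i)
    apply Set.Finite.of_finite_image (f := f)
    · apply (Set.Finite.pi' (t := fun i => {v : K | ((P i).map φ.toRingHom).IsRoot v})
        (fun i => Polynomial.finite_setOfPred_isRoot ((hP i).map _).ne_zero)).subset
      rintro _ ⟨τ, hτ, rfl⟩ i
      have := congrArg τ (hPx i)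
      have hc : φ.toRingHom = τ.toRingHom.comp (algebraMap A C) := by
        ext a; exact (hτ a).symm
      rw [Set.mem_ofPred_eq, Polynomial.IsRoot, Polynomial.eval_map, hc]
      rw [map_zero] at this
      rw [← this]
      exact (Polynomial.hom_eval₂ _ _ _ _).symm
    · intro τ hτ τ' hτ' h
      apply AlgHom.ext_of_adjoin_eq_top hx
      rintro _ ⟨i, rfl⟩
      have := congrFun h i
      simp only [f, Algebra.smul_def, map_mul] at this
      rw [hτ, hτ'] at this
      exact mul_left_cancel₀ hφ2 this
  refine ⟨φ, hfin, ?_⟩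
  let At := Localization.Away t1
  have hinjA : Function.Injective (algebraMap A Ω) := FaithfulSMul.algebraMap_injective A Ω
  have hun : IsUnit (algebraMap A Ω t1) :=
    (IsUnit.mk0 _ ((map_ne_zero_iff _ hinjA).2 ht1))
  let e : At →+* Ω := IsLocalization.Away.lift t1 hun
  let φt : At →+* K := IsLocalization.Away.lift t1 (g := φ.toRingHom) (IsUnit.mk0 _ hφ1)
  have hφt : ∀ a, φt (algebraMap A At a) = φ a := fun a => IsLocalization.Away.lift_eq _ _ _
  have he : ∀ a, e (algebraMap A At a) = algebraMap A Ω a := fun a => IsLocalization.Away.lift_eq _ _ _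
  let := e.toAlgebra
  have : IsScalarTower A At Ω := IsScalarTower.of_algebraMap_eq (fun a => (he a).symm)
  have hmon : Submonoid.powers t1 ≤ nonZeroDivisors A :=
    powers_le_nonZeroDivisors_of_noZeroDivisors ht1
  have hinje : Function.Injective e := by
    refine (IsLocalization.lift_injective_iff _).2 fun a b => ?_
    rw [(IsLocalization.injective At hmon).eq_iff, hinjA.eq_iff]
  let R := integralClosure At Ω
  have hinj : Function.Injective (algebraMap At R) := by
    have : Function.Injective (algebraMap At Ω) := hinje
    rw [IsScalarTower.algebraMap_eq At R Ω, RingHom.coe_comp] at this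
    exact Function.Injective.of_comp this
  obtain ⟨ψ, hψ⟩ := ext_hom (R := R) hinj φt
  have hmem : ∀ z : Ω, IsIntegral A (t1 • z) → z ∈ R := by
    intro z hz
    have h3 : IsIntegral At (t1 • z) := hz.tower_top
    have h4 : IsIntegral At (algebraMap At Ω (IsLocalization.Away.invSelf t1)) := isIntegral_algebraMap
    have := h4.mul h3
    rw [Algebra.smul_def, ← mul_assoc, IsScalarTower.algebraMap_apply A At Ω, ← map_mul,
      mul_comm (IsLocalization.Away.invSelf t1), IsLocalization.Away.mul_invSelf, map_one, one_mul] at this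
    exact this
  have hA0 : ∀ a, algebraMap A Ω a ∈ R := fun a => by
    rw [IsScalarTower.algebraMap_apply A At Ω]
    exact Subalgebra.algebraMap_mem R _
  have hσR : ∀ j c, σ j c ∈ R := by
    intro j c
    have hc : c ∈ Algebra.adjoin K (Set.range x) := hx ▸ Algebra.mem_top
    induction hc using Algebra.adjoin_induction with
    | mem c hc =>
      obtain ⟨i, rfl⟩ := hc
      exact hmem _ (h1 _ (Finset.mem_union_left _ (Finset.mem_image.2 ⟨(j, i), Finset.mem_univ _, rfl⟩)))
    | algebraMap r =>
      rw [IsScalarTower.algebraMap_apply K A C, AlgHom.commutes]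
      exact hA0 _
    | add c d _ _ hc hd => rw [map_add]; exact R.add_mem hc hd
    | mul c d _ _ hc hd => rw [map_mul]; exact R.mul_mem hc hd
  have hψA : ∀ a h, ψ ⟨algebraMap A Ω a, h⟩ = φ a := by
    intro a h
    rw [← hφt, ← hψ]
    congr 1
    apply Subtype.ext
    exact (he a).symm
  let τ : J → (C →ₐ[K] K) := fun j =>
    { ψ.comp ((σ j).toRingHom.codRestrict R (hσR j)) with
      commutes' := fun k => by
        change ψ ⟨σ j (algebraMap K C k), _⟩ = k
        have : σ j (algebraMap K C k) = algebraMap A Ω (algebraMap K A k) := by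
          rw [IsScalarTower.algebraMap_apply K A C, AlgHom.commutes]
        simp only [this]
        rw [hψA]; simp }
  have hτ : ∀ j c, τ j c = ψ ⟨σ j c, hσR j c⟩ := fun j c => rfl
  have hτinj : Function.Injective τ := by
    intro i j hij
    by_contra hne
    have hne' : σ i u - σ j u ≠ 0 := fun h => hne (hσ (sub_eq_zero.1 h))
    have hm : (σ i u - σ j u)⁻¹ ∈ R :=
      hmem _ (h1 _ (Finset.mem_union_right _ (Finset.mem_image.2 ⟨(i, j), Finset.mem_univ _, rfl⟩)))
    have h5 : ((⟨σ i u, hσR i u⟩ - ⟨σ j u, hσR j u⟩ : R)) * ⟨_, hm⟩ = 1 :=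
      Subtype.ext (mul_inv_cancel₀ hne')
    have h6 := congrArg ψ h5
    rw [map_mul, map_sub, ← hτ, ← hτ, hij, sub_self, zero_mul, map_one] at h6
    exact zero_ne_one h6
  rw [← Set.ncard_univ, ← Set.ncard_image_of_injective _ hτinj]
  apply Set.ncard_le_ncard _ hfin
  rintro _ ⟨j, -, rfl⟩ a
  have : σ j (algebraMap A C a) = algebraMap A Ω a := (σ j).commutes a
  rw [hτ]
  simp only [this]
  exact hψA _ _

universe u v w
theorem lem_E1 {K : Type u} {C : Type v} [Field K] [CommRing C] [IsDomain C]
    [Algebra K C] {n : ℕ} (x : Fin n → C) (hx : Algebra.adjoin K (Set.range x) = ⊤) :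
    ∃ τ : ℕ, ∀ (ι : Type v) [Fintype ι] (l : ι → C), IsTranscendenceBasis K l →
      (∀ i, l i ∈ Submodule.span K (insert 1 (Set.range x))) →
      ∀ z ∈ Submodule.span K (insert 1 (Set.range x)),
        ∃ P : Polynomial (MvPolynomial ι K), P ≠ 0 ∧ P.natDegree ≤ τ ∧
          P.eval₂ (aeval l).toRingHom z = 0 := by
  classical
  have hft : Algebra.FiniteType K C :=
    ⟨⟨Finset.univ.image x, by simpa using hx⟩⟩
  obtain ⟨s, g, hginj, hgfin⟩ := exists_finite_inj_algHom_of_fg K C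
  have hbase : IsTranscendenceBasis K (fun i => g (X i)) := by
    have hg : (aeval (fun i => g (X i)) : MvPolynomial (Fin s) K →ₐ[K] C) = g := by
      ext i; simp
    have hli : AlgebraicIndependent K (fun i => g (X i)) := by
      rw [algebraicIndependent_iff_injective_aeval, hg]
      exact hginj
    rw [hli.isTranscendenceBasis_iff_isAlgebraic]
    refine ⟨fun c => ?_⟩
    obtain ⟨P, hP, hPc⟩ := hgfin.to_isIntegral c
    apply IsIntegral.isAlgebraic
    have hmem : ∀ p, g p ∈ Algebra.adjoin K (Set.range fun i => g (X i)) := by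
      intro p
      rw [Algebra.adjoin_range_eq_range_aeval, hg]
      exact ⟨p, rfl⟩
    refine ⟨P.map (g.toRingHom.codRestrict _ hmem), hP.map _, ?_⟩
    rw [Polynomial.eval₂_map]
    exact hPc
  obtain ⟨M, b, hb⟩ : ∃ (M : ℕ) (b : Fin M → C), ∀ c : C, ∃ p : Fin M → MvPolynomial (Fin s) K,
      c = ∑ k, g (p k) * b k := by
    let := g.toRingHom.toAlgebra
    have : Module.Finite (MvPolynomial (Fin s) K) C := hgfin
    obtain ⟨M, b, hb⟩ := Module.Finite.exists_fin (R := MvPolynomial (Fin s) K) (M := C)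
    refine ⟨M, b, fun c => ?_⟩
    have : c ∈ Submodule.span (MvPolynomial (Fin s) K) (Set.range b) := hb ▸ Submodule.mem_top
    obtain ⟨p, hp⟩ := (Submodule.mem_span_range_iff_exists_fun _).1 this
    refine ⟨p, ?_⟩
    rw [← hp]
    exact Finset.sum_congr rfl fun k _ => Algebra.smul_def _ _
  let w (t : ℕ) : (Fin s → Fin (t + 1)) × Fin M → C := fun q =>
    g (∏ i, X i ^ (q.1 i : ℕ)) * b q.2
  let W (t : ℕ) : Submodule K C := Submodule.span K (Set.range (w t))
  have hWmem : ∀ t (e : Fin s → ℕ) k, (∀ i, e i ≤ t) → g (∏ i, X i ^ (e i)) * b k ∈ W t := by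
    intro t e k he
    exact Submodule.subset_span ⟨(fun i => ⟨e i, Nat.lt_succ_of_le (he i)⟩, k), rfl⟩
  have hWind : ∀ t (V : Submodule K C), (∀ (e : Fin s → ℕ) k, (∀ i, e i ≤ t) →
      g (∏ i, X i ^ (e i)) * b k ∈ V) → W t ≤ V := by
    intro t V h
    refine Submodule.span_le.2 ?_
    rintro _ ⟨⟨e, k⟩, rfl⟩
    exact h (fun i => e i) k (fun i => Nat.le_of_lt_succ (e i).2)
  have hWmono : ∀ t t', t ≤ t' → W t ≤ W t' := fun t t' h =>
    hWind _ _ fun e k he => hWmem _ _ _ fun i => (he i).trans h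
  have hWex : ∀ c, ∃ t, c ∈ W t := by
    have hone : ∀ (p : MvPolynomial (Fin s) K) k, ∃ t, g p * b k ∈ W t := by
      intro p k
      induction p using MvPolynomial.induction_on' with
      | monomial e a =>
        refine ⟨Finset.univ.sup e, ?_⟩
        have := (W (Finset.univ.sup e)).smul_mem a
          (hWmem _ e k (fun i => Finset.le_sup (Finset.mem_univ i)))
        convert this using 1
        rw [monomial_eq, ← smul_eq_C_mul, map_smul, smul_mul_assoc,
          Finsupp.prod_fintype _ _ (by simp)]
      | add p q hp hq =>
        obtain ⟨t, ht⟩ := hp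
        obtain ⟨t', ht'⟩ := hq
        refine ⟨max t t', ?_⟩
        rw [map_add, add_mul]
        exact add_mem (hWmono _ _ (le_max_left _ _) ht) (hWmono _ _ (le_max_right _ _) ht')
    intro c
    obtain ⟨p, hp⟩ := hb c
    choose t ht using fun k => hone (p k) k
    refine ⟨Finset.univ.sup t, ?_⟩
    rw [hp]
    exact sum_mem fun k _ => hWmono _ _ (Finset.le_sup (Finset.mem_univ k)) (ht k)
  choose tt htt using hWex
  let κ := max (tt 1) (Finset.univ.sup (fun q : Fin n × Fin M => tt (x q.1 * b q.2)))
  have hκ1 : (1 : C) ∈ W κ := hWmono _ _ (le_max_left _ _) (htt 1)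
  have hκx : ∀ i k, x i * b k ∈ W κ := fun i k => hWmono _ _
    ((Finset.le_sup (f := fun q : Fin n × Fin M => tt (x q.1 * b q.2))
      (Finset.mem_univ (i, k))).trans (le_max_right _ _)) (htt _)
  have hshift : ∀ t (e : Fin s → ℕ), (∀ i, e i ≤ t) → ∀ c ∈ W κ,
      g (∏ i, X i ^ (e i)) * c ∈ W (t + κ) := by
    intro t e he c hc
    have : W κ ≤ (W (t + κ)).comap (LinearMap.mulLeft K (g (∏ i, X i ^ (e i)))) := by
      refine hWind _ _ fun e' k he' => ?_
      rw [Submodule.mem_comap, LinearMap.mulLeft_apply, ← mul_assoc, ← map_mul,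
        ← Finset.prod_mul_distrib]
      simp only [← pow_add]
      exact hWmem _ (fun i => e i + e' i) _ fun i => add_le_add (he i) (he' i)
    exact this hc
  let E := Submodule.span K (insert 1 (Set.range x))
  have hmul : ∀ z ∈ E, ∀ t, ∀ c ∈ W t, z * c ∈ W (t + κ) := by
    intro z hz t c hc
    have h1 : E ≤ (W (t + κ)).comap (LinearMap.mulRight K c) := by
      refine Submodule.span_le.2 ?_
      rintro z (rfl | ⟨i, rfl⟩)
      · rw [SetLike.mem_coe, Submodule.mem_comap, LinearMap.mulRight_apply, one_mul]
        exact hWmono _ _ (Nat.le_add_right _ _) hc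
      · have h2 : W t ≤ (W (t + κ)).comap (LinearMap.mulLeft K (x i)) := by
          refine hWind _ _ fun e k he => ?_
          have := hshift t e he _ (hκx i k)
          rw [Submodule.mem_comap, LinearMap.mulLeft_apply]
          convert this using 1
          ring
        exact h2 hc
    exact h1 hz
  have hpow : ∀ z ∈ E, ∀ m t, ∀ c ∈ W t, z ^ m * c ∈ W (t + m * κ) := by
    intro z hz m
    induction m with
    | zero => intro t c hc; simpa using hc
    | succ m ih =>
      intro t c hc
      have := hmul z hz _ _ (ih t c hc)
      have e1 : z ^ (m + 1) * c = z * (z ^ m * c) := by ring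
      have e2 : t + (m + 1) * κ = t + m * κ + κ := by ring
      rw [e1, e2]
      exact this
  have hfr : ∀ t, Module.finrank K (W t) ≤ M * (t + 1) ^ s := by
    intro t
    have := finrank_range_le_card (R := K) (w t)
    simp only [Fintype.card_prod, Fintype.card_fun, Fintype.card_fin] at this
    rw [mul_comm]
    exact this
  have hWfin : ∀ t, Module.Finite K (W t) := fun t =>
    Module.Finite.span_of_finite K (Set.finite_range _)
  let N0 := M * (κ * (s + 2) + 1) ^ s + 1
  refine ⟨N0, fun ι _ l hl hlE z hz => ?_⟩
  have hcard : Fintype.card ι = s := by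
    have := hl.lift_cardinalMk_eq hbase
    simpa using this
  let y : Option ι → C := fun o => o.elim z l
  have hy : ∀ o, y o ∈ E := by
    rintro (_ | i)
    · exact hz
    · exact hlE i
  have hprod : ∀ (a : Option ι → ℕ) (S : Finset (Option ι)),
      ∏ o ∈ S, y o ^ a o ∈ W (κ + (∑ o ∈ S, a o) * κ) := by
    intro a S
    induction S using Finset.induction_on with
    | empty => simpa using hκ1
    | insert o S ho ih =>
      rw [Finset.prod_insert ho, Finset.sum_insert ho]
      have := hpow _ (hy o) (a o) _ _ ih
      convert this using 2
      ring
  let T := κ * (s + 2) * N0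
  have hN0 : 1 ≤ N0 := Nat.le_add_left _ _
  have hyT : ∀ a : Option ι → Fin N0, ∏ o, y o ^ (a o : ℕ) ∈ W T := by
    intro a
    refine hWmono _ _ ?_ (hprod (fun o => a o) Finset.univ)
    have h1 : ∑ o, (a o : ℕ) ≤ (s + 1) * N0 := by
      have := Finset.sum_le_card_nsmul Finset.univ (fun o => (a o : ℕ)) N0 (fun o _ => (a o).2.le)
      simpa [hcard] using this
    calc κ + (∑ o, (a o : ℕ)) * κ ≤ κ * N0 + ((s + 1) * N0) * κ := by
          gcongr
          exact Nat.le_mul_of_pos_right _ hN0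
      _ = T := by simp only [T]; ring
  have hdep : ¬ LinearIndependent K (fun a : Option ι → Fin N0 => (⟨_, hyT a⟩ : W T)) := by
    intro h
    have h1 := h.fintype_card_le_finrank.trans (hfr T)
    simp only [Fintype.card_fun, Fintype.card_fin, Fintype.card_option, hcard] at h1
    have h2 : M * (T + 1) ^ s < N0 ^ (s + 1) := by
      calc M * (T + 1) ^ s ≤ M * ((κ * (s + 2) + 1) * N0) ^ s := by
            gcongr
            simp only [T]
            rw [add_mul]
            omega
        _ = (M * (κ * (s + 2) + 1) ^ s) * N0 ^ s := by rw [mul_pow, mul_assoc]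
        _ < N0 * N0 ^ s := by
            apply Nat.mul_lt_mul_of_pos_right (Nat.lt_succ_self _)
            positivity
        _ = N0 ^ (s + 1) := by ring
    omega
  obtain ⟨c, hc, a0, ha0⟩ := Fintype.not_linearIndependent_iff.1 hdep
  let ex : (Option ι → Fin N0) → (Option ι →₀ ℕ) := fun a =>
    Finsupp.equivFunOnFinite.symm (fun o => (a o : ℕ))
  have hexinj : Function.Injective ex := by
    intro a a' h
    have := Finsupp.equivFunOnFinite.symm.injective h
    funext o
    exact Fin.ext (congrFun this o)
  let Q : MvPolynomial (Option ι) K := ∑ a, monomial (ex a) (c a)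
  have hQ0 : Q ≠ 0 := by
    intro h
    have := congrArg (coeff (ex a0)) h
    simp only [Q, coeff_sum, coeff_monomial, coeff_zero, hexinj.eq_iff] at this
    simp at this
    exact ha0 this
  have hQy : aeval y Q = 0 := by
    have := congrArg Subtype.val hc
    simp only [Q, map_sum, aeval_monomial]
    rw [AddSubmonoidClass.coe_finsetSum] at this
    rw [← Submodule.coe_zero (p := W T), ← this]
    refine Finset.sum_congr rfl fun a _ => ?_
    rw [Finsupp.prod_fintype _ _ (by simp), ← Algebra.smul_def]
    rfl
  refine ⟨optionEquivLeft K ι Q, ?_, ?_, ?_⟩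
  · rwa [Ne, EmbeddingLike.map_eq_zero_iff]
  · rw [natDegree_optionEquivLeft, degreeOf_le_iff]
    intro m hm
    obtain ⟨a, -, ha⟩ := Finset.mem_biUnion.1 (support_sum hm)
    have := Finset.mem_singleton.1 (support_monomial_subset ha)
    rw [this]
    exact (a none).2.le
  · rw [← hQy]
    have : (Polynomial.eval₂RingHom (aeval l).toRingHom z).comp
        (optionEquivLeft K ι).toRingHom = (aeval y).toRingHom := by
      apply MvPolynomial.ringHom_ext
      · intro r; simp
      · rintro (_ | i) <;> simp [y]
    exact RingHom.congr_fun this Q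

theorem lem_E2 {K : Type u} {C : Type v} [Field K] [CommRing C] [IsDomain C]
    [Algebra K C] {n : ℕ} (x : Fin n → C) (hx : Algebra.adjoin K (Set.range x) = ⊤) :
    ∃ T : ℕ, ∀ (ι : Type v) [Fintype ι] (l : ι → C), IsTranscendenceBasis K l →
      (∀ i, l i ∈ Submodule.span K (insert 1 (Set.range x))) →
      ∀ (Ω : Type v) (J : Type u) [Finite J] [Field Ω] [Algebra (Algebra.adjoin K (Set.range l)) Ω]
      [FaithfulSMul (Algebra.adjoin K (Set.range l)) Ω]
      (σ : J → (C →ₐ[Algebra.adjoin K (Set.range l)] Ω)), Function.Injective σ →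
      Nat.card J ≤ T := by
  classical
  obtain ⟨τ, hτ⟩ := lem_E1 (K := K) x hx
  refine ⟨τ ^ n, fun ι _ l hl hlE Ω J _ _ _ _ σ hσ => ?_⟩
  have := Fintype.ofFinite J
  let A := Algebra.adjoin K (Set.range l)
  choose P hP0 hPd hP using fun i => hτ ι l hl hlE (x i)
    (Submodule.subset_span (Or.inr ⟨i, rfl⟩))
  let e : MvPolynomial ι K →+* A := hl.1.aevalEquiv.toRingEquiv.toRingHom
  have he : Function.Injective e := hl.1.aevalEquiv.injective
  have hec : (algebraMap A C).comp e = (aeval l).toRingHom := by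
    ext a
    · simp [e]
    · simp [e]
  let Q : Fin n → Polynomial Ω := fun i => ((P i).map e).map (algebraMap A Ω)
  have hQ0 : ∀ i, Q i ≠ 0 := fun i => by
    rw [Polynomial.map_ne_zero_iff (FaithfulSMul.algebraMap_injective A Ω),
      Polynomial.map_ne_zero_iff he]
    exact hP0 i
  have hQr : ∀ i j, σ j (x i) ∈ (Q i).roots.toFinset := by
    intro i j
    rw [Multiset.mem_toFinset, Polynomial.mem_roots (hQ0 i), Polynomial.IsRoot]
    have h1 : Polynomial.aeval (x i) ((P i).map e) = 0 := by
      rw [Polynomial.aeval_def, Polynomial.eval₂_map, hec]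
      exact hP i
    have h2 := congrArg (σ j) h1
    rw [map_zero, ← Polynomial.aeval_algHom_apply] at h2
    rw [Polynomial.eval_map_algebraMap]
    exact h2
  let f : J → Fintype.piFinset (fun i => (Q i).roots.toFinset) := fun j =>
    ⟨fun i => σ j (x i), Fintype.mem_piFinset.2 fun i => hQr i j⟩
  have hf : Function.Injective f := by
    intro j j' h
    apply hσ
    have h1 := congrArg Subtype.val h
    ext c
    have hc : c ∈ Algebra.adjoin K (Set.range x) := hx ▸ Algebra.mem_top
    induction hc using Algebra.adjoin_induction with
    | mem c hc =>
      obtain ⟨i, rfl⟩ := hc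
      exact congrFun h1 i
    | algebraMap r =>
      rw [IsScalarTower.algebraMap_apply K A C, AlgHom.commutes, AlgHom.commutes]
    | add c d _ _ hc hd => rw [map_add, map_add, hc, hd]
    | mul c d _ _ hc hd => rw [map_mul, map_mul, hc, hd]
  rw [Nat.card_eq_fintype_card]
  refine (Fintype.card_le_of_injective f hf).trans ?_
  rw [Fintype.card_coe, Fintype.card_piFinset]
  calc ∏ i, (Q i).roots.toFinset.card ≤ ∏ i : Fin n, τ := by
        refine Finset.prod_le_prod' fun i _ => ?_
        refine (Multiset.toFinset_card_le _).trans ((Polynomial.card_roots' _).trans ?_)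
        exact (Polynomial.natDegree_map_le.trans Polynomial.natDegree_map_le).trans (hPd i)
    _ = τ ^ n := by simp

set_option maxHeartbeats 1000000 in
theorem lem_M {K : Type u} {B : Type w} {C : Type v} [Field K] [IsAlgClosed K]
    [CommRing B] [IsDomain B] [Algebra K B] [Algebra.FiniteType K B]
    [CommRing C] [IsDomain C] [Algebra K C] [Algebra B C] [IsScalarTower K B C] [FaithfulSMul B C]
    {n : ℕ} (x : Fin n → C) (hx : Algebra.adjoin K (Set.range x) = ⊤)
    {N : ℕ} (f : Fin N → B)
    (hfin : {p : B →ₐ[K] K | ∀ i, p (f i) = 0}.Finite)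
    (hne : {p : B →ₐ[K] K | ∀ i, p (f i) = 0}.Nonempty) :
    ∃ (ι : Type v) (_ : Fintype ι) (l : ι → C), IsTranscendenceBasis K l ∧
      (∀ i, (∃ j, l i = x j) ∨ ∃ b ∈ Submodule.span K (Set.range f), l i = algebraMap B C b) ∧
      ∃ (u : C) (ψ : Algebra.adjoin K (Set.range l) →+* K),
        IsIntegral (Algebra.adjoin K (Set.range l)) u ∧
        ∃ v : {p : B →ₐ[K] K | ∀ i, p (f i) = 0} → K, Function.Injective v ∧
          ∀ p, Polynomial.eval₂ ψ (v p) (minpoly (Algebra.adjoin K (Set.range l)) u) = 0 := by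
  classical
  obtain ⟨d, l, hl, hlt, u, hu, huinj⟩ := key_B f hfin hne
  have hxB : Algebra.adjoin B (Set.range x) = ⊤ := by
    rw [eq_top_iff]
    intro c _
    have hc : c ∈ Algebra.adjoin K (Set.range x) := hx ▸ Algebra.mem_top
    have : Algebra.adjoin K (Set.range x) ≤ (Algebra.adjoin B (Set.range x)).restrictScalars K :=
      Algebra.adjoin_le Algebra.subset_adjoin
    exact this hc
  have halg : Algebra.IsAlgebraic (Algebra.adjoin B (Set.range x)) C := by
    refine ⟨fun c => ?_⟩
    have hc : c ∈ Algebra.adjoin B (Set.range x) := hxB ▸ Algebra.mem_top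
    exact isAlgebraic_algebraMap (⟨c, hc⟩ : Algebra.adjoin B (Set.range x))
  obtain ⟨m, hmx, hm⟩ := exists_isTranscendenceBasis_subset (R := B) (Set.range x)
  have hmfin : m.Finite := (Set.finite_range x).subset hmx
  have := hmfin.fintype
  let l' : m ⊕ Fin d → C := Sum.elim Subtype.val (algebraMap B C ∘ l)
  have hl' : IsTranscendenceBasis K l' := hlt.sumElim_comp hm
  refine ⟨m ⊕ Fin d, inferInstance, l', hl', ?_, ?_⟩
  · rintro (i | i)
    · obtain ⟨j, hj⟩ := hmx i.2
      exact Or.inl ⟨j, hj.symm⟩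
    · exact Or.inr ⟨l i, hl i, rfl⟩
  let A := Algebra.adjoin K (Set.range l')
  let D := Algebra.adjoin B (Set.range (Subtype.val : m → C))
  have hAD : ∀ a : A, (a : C) ∈ D := by
    have : A ≤ D.restrictScalars K := by
      refine Algebra.adjoin_le ?_
      rintro _ ⟨i | i, rfl⟩
      · have h1 : (i : C) ∈ D := Algebra.subset_adjoin ⟨i, rfl⟩
        exact h1
      · have h1 : algebraMap B C (l i) ∈ D := D.algebraMap_mem (l i)
        exact h1
    exact fun a => this a.2
  let j : A →+* D := (algebraMap A C).codRestrict D hAD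
  let θ : (B →ₐ[K] K) → (D →+* K) := fun p =>
    (eval₂Hom p.toRingHom (fun _ => 0)).comp hm.1.aevalEquiv.symm.toRingEquiv.toRingHom
  have hθB : ∀ p b, θ p (algebraMap B D b) = p b := by
    intro p b
    have : hm.1.aevalEquiv.symm (algebraMap B D b) = algebraMap B _ b := AlgEquiv.commutes _ _
    change eval₂Hom p.toRingHom (fun _ => 0) (hm.1.aevalEquiv.symm (algebraMap B D b)) = _
    rw [this]
    simp [MvPolynomial.algebraMap_eq]
  have hθm : ∀ p (i : m) h, θ p ⟨(i : C), h⟩ = 0 := by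
    intro p i h
    have : hm.1.aevalEquiv.symm (⟨(i : C), h⟩ : D) = X i := by
      rw [AlgEquiv.symm_apply_eq]
      apply Subtype.ext
      simp
    change eval₂Hom p.toRingHom (fun _ => 0) (hm.1.aevalEquiv.symm ⟨(i : C), h⟩) = _
    rw [this]
    simp
  clear_value θ
  let S := {p : B →ₐ[K] K | ∀ i, p (f i) = 0}
  have hpl : ∀ p ∈ S, ∀ i, p (l i) = 0 := by
    intro p hp i
    have : Submodule.span K (Set.range f) ≤ LinearMap.ker p.toLinearMap := by
      refine Submodule.span_le.2 ?_
      rintro _ ⟨i, rfl⟩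
      exact hp i
    exact this (hl i)
  have hθA : ∀ p ∈ S, ∀ p' ∈ S, (θ p).comp j = (θ p').comp j := by
    intro p hp p' hp'
    ext ⟨a, ha⟩
    induction ha using Algebra.adjoin_induction with
    | mem a ha =>
      obtain ⟨i | i, rfl⟩ := ha
      · change θ p ⟨(i : C), _⟩ = θ p' ⟨(i : C), _⟩
        exact (hθm p i _).trans (hθm p' i _).symm
      · change θ p (algebraMap B D (l i)) = θ p' (algebraMap B D (l i))
        rw [hθB, hθB, hpl p hp, hpl p' hp']
    | algebraMap r =>
      have : j (⟨algebraMap K C r, A.algebraMap_mem r⟩) = algebraMap B D (algebraMap K B r) :=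
        Subtype.ext (IsScalarTower.algebraMap_apply K B C r)
      change θ p (j ⟨algebraMap K C r, _⟩) = θ p' (j ⟨algebraMap K C r, _⟩)
      rw [this, hθB, hθB, AlgHom.commutes, AlgHom.commutes]
    | add a b ha hb h1 h2 =>
      have : (⟨a + b, A.add_mem ha hb⟩ : A) = ⟨a, ha⟩ + ⟨b, hb⟩ := rfl
      rw [this, map_add, map_add, h1, h2]
    | mul a b ha hb h1 h2 =>
      have : (⟨a * b, A.mul_mem ha hb⟩ : A) = ⟨a, ha⟩ * ⟨b, hb⟩ := rfl
      rw [this, map_mul, map_mul, h1, h2]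
  obtain ⟨p0, hp0⟩ := hne
  refine ⟨algebraMap B C u, (θ p0).comp j, ?_, fun p => p.1 u, ?_, ?_⟩
  · obtain ⟨P, hP, hPu⟩ := hu
    have hmem : ∀ b : Algebra.adjoin K (Set.range l), algebraMap B C b ∈ A := by
      have : Algebra.adjoin K (Set.range l) ≤ A.comap (IsScalarTower.toAlgHom K B C) := by
        refine Algebra.adjoin_le ?_
        rintro _ ⟨i, rfl⟩
        exact Algebra.subset_adjoin ⟨Sum.inr i, rfl⟩
      exact fun b => this b.2
    let g : Algebra.adjoin K (Set.range l) →+* A :=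
      ((algebraMap B C).comp (algebraMap _ B)).codRestrict A hmem
    refine ⟨P.map g, hP.map _, ?_⟩
    rw [Polynomial.eval₂_map]
    have := congrArg (algebraMap B C) hPu
    rw [map_zero, Polynomial.hom_eval₂] at this
    exact this
  · intro p q h
    exact Subtype.ext (huinj p.2 q.2 h)
  · intro p
    rw [hθA p0 hp0 p.1 p.2]
    have h1 : Polynomial.eval₂ (algebraMap A C) (algebraMap B C u)
      (minpoly A (algebraMap B C u)) = 0 := minpoly.aeval _ _
    have h2 : Polynomial.eval₂ j (algebraMap B D u) (minpoly A (algebraMap B C u)) = 0 := by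
      apply Subtype.val_injective
      have h3 := Polynomial.hom_eval₂ (minpoly A (algebraMap B C u)) j D.val.toRingHom
        (algebraMap B D u)
      exact h3.trans h1
    have h4 := congrArg (θ p.1) h2
    rw [map_zero, Polynomial.hom_eval₂, hθB] at h4
    exact h4

theorem lem_N {K : Type u} {B : Type w} {C : Type v} [Field K] [IsAlgClosed K]
    [CommRing B] [IsDomain B] [Algebra K B] [Algebra.FiniteType K B]
    [CommRing C] [IsDomain C] [Algebra K C] [Algebra B C] [IsScalarTower K B C] [FaithfulSMul B C]
    {n : ℕ} (x : Fin n → C) (hx : Algebra.adjoin K (Set.range x) = ⊤) :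
    ∃ T : ℕ, ∀ {N : ℕ} (f : Fin N → B), {p : B →ₐ[K] K | ∀ i, p (f i) = 0}.Finite →
    (∀ i, algebraMap B C (f i) ∈ Submodule.span K (insert 1 (Set.range x))) →
    {p : B →ₐ[K] K | ∀ i, p (f i) = 0}.Nonempty →
    {p : B →ₐ[K] K | ∀ i, p (f i) = 0}.ncard ≤ T ∧
    ∃ (ι : Type v) (_ : Fintype ι) (l : ι → C),
      (∀ i, l i ∈ Submodule.span K (insert 1 (Set.range x))) ∧
      ∃ a : ι → K, {τ : C →ₐ[K] K | ∀ i, τ (l i) = a i}.Finite ∧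
        {p : B →ₐ[K] K | ∀ i, p (f i) = 0}.ncard ≤ {τ : C →ₐ[K] K | ∀ i, τ (l i) = a i}.ncard := by
  classical
  obtain ⟨T, hT⟩ := lem_E2 (K := K) x hx
  refine ⟨T, fun {N} f hfin hfx hne => ?_⟩
  obtain ⟨ι, hι, l, hl, hlx, u, ψ, hu, v, hv, hvr⟩ := lem_M x hx f hfin hne
  have hlE : ∀ i, l i ∈ Submodule.span K (insert 1 (Set.range x)) := by
    intro i
    rcases hlx i with ⟨j, hj⟩ | ⟨b, hb, hj⟩
    · rw [hj]; exact Submodule.subset_span (Or.inr ⟨j, rfl⟩)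
    · rw [hj]
      have : Submodule.span K (Set.range f) ≤ (Submodule.span K (insert 1 (Set.range x))).comap
          (IsScalarTower.toAlgHom K B C).toLinearMap := by
        refine Submodule.span_le.2 ?_
        rintro _ ⟨i, rfl⟩
        exact hfx i
      exact this hb
  let A := Algebra.adjoin K (Set.range l)
  let Ω := AlgebraicClosure (FractionRing A)
  have hic : IsIntegrallyClosed A := IsIntegrallyClosed.of_equiv hl.1.aevalEquiv.toRingEquiv
  have halgC : Algebra.IsAlgebraic A C := hl.isAlgebraic
  have hfA : FaithfulSMul A Ω := by
    rw [faithfulSMul_iff_algebraMap_injective, IsScalarTower.algebraMap_eq A (FractionRing A) Ω]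
    exact (algebraMap (FractionRing A) Ω).injective.comp (IsFractionRing.injective A _)
  have halgΩ : Algebra.IsAlgebraic A Ω :=
    (IsFractionRing.comap_isAlgebraic_iff (K := FractionRing A)).2 inferInstance
  obtain ⟨σ, hσ⟩ := lem_C (Ω := Ω) ψ u hu
  let J := {v : K // Polynomial.eval₂ ψ v (minpoly A u) = 0}
  have hJ : Finite J := by
    have h0 : (minpoly A u).map ψ ≠ 0 := ((minpoly.monic hu).map ψ).ne_zero
    have := Polynomial.finite_setOfPred_isRoot h0
    refine Set.Finite.to_subtype (this.subset fun v hv => ?_)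
    rw [Set.mem_ofPred_eq, Polynomial.IsRoot, Polynomial.eval_map]
    exact hv
  have hle : {p : B →ₐ[K] K | ∀ i, p (f i) = 0}.ncard ≤ Nat.card J := by
    let g : {p : B →ₐ[K] K | ∀ i, p (f i) = 0} → J := fun p => ⟨v p, hvr p⟩
    exact Nat.card_le_card_of_injective g fun p q h => hv (congrArg Subtype.val h)
  have hσi : Function.Injective σ := fun i j h => hσ (by simp only [h])
  have hA : ∀ t : A, t ≠ 0 → ∃ φ : A →ₐ[K] K, φ t ≠ 0 := by
    intro t ht
    have hK : Infinite K := IsAlgClosed.instInfinite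
    have h0 : hl.1.aevalEquiv.symm t ≠ 0 := by simpa using ht
    obtain ⟨y, hy⟩ : ∃ y : ι → K, eval y (hl.1.aevalEquiv.symm t) ≠ 0 := by
      by_contra! h
      exact h0 (MvPolynomial.funext fun y => by rw [h y, map_zero])
    refine ⟨(aeval y).comp hl.1.aevalEquiv.symm.toAlgHom, ?_⟩
    simpa [aeval_eq_eval] using hy
  obtain ⟨φ, hφfin, hφ⟩ := lem_D hA x hx u σ hσ
  refine ⟨hle.trans (hT ι l hl hlE Ω J σ hσi), ι, hι, l, hlE,
    fun i => φ ⟨l i, Algebra.subset_adjoin ⟨i, rfl⟩⟩, ?_⟩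
  have hset : {τ : C →ₐ[K] K | ∀ i, τ (l i) = φ ⟨l i, Algebra.subset_adjoin ⟨i, rfl⟩⟩} =
      {τ : C →ₐ[K] K | ∀ a, τ (algebraMap A C a) = φ a} := by
    ext τ
    constructor
    · rintro h ⟨a, ha⟩
      change τ a = _
      induction ha using Algebra.adjoin_induction with
      | mem a ha => obtain ⟨i, rfl⟩ := ha; exact h i
      | algebraMap r => rw [AlgHom.commutes]; exact (φ.commutes r).symm
      | add a b ha hb h1 h2 =>
        have : (⟨a + b, A.add_mem ha hb⟩ : A) = ⟨a, ha⟩ + ⟨b, hb⟩ := rfl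
        rw [this, map_add, map_add, h1, h2]
      | mul a b ha hb h1 h2 =>
        have : (⟨a * b, A.mul_mem ha hb⟩ : A) = ⟨a, ha⟩ * ⟨b, hb⟩ := rfl
        rw [this, map_mul, map_mul, h1, h2]
    · intro h i
      exact h ⟨l i, _⟩
  rw [hset]
  exact ⟨hφfin, hle.trans hφ⟩

theorem lin_span {K : Type*} [Field K] {ν : ℕ} (g : MvPolynomial (Fin ν) K)
    (hg : g.totalDegree ≤ 1) :
    g ∈ Submodule.span K (insert 1 (Set.range (X : Fin ν → MvPolynomial (Fin ν) K))) := by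
  classical
  rw [g.as_sum]
  refine sum_mem fun m hm => ?_
  have h1 : m.sum (fun _ e => e) ≤ 1 := (le_totalDegree hm).trans hg
  have h2 : monomial m (coeff m g) = coeff m g • monomial m (1 : K) := by
    rw [smul_monomial, smul_eq_mul, mul_one]
  rw [h2]
  refine Submodule.smul_mem _ _ (Submodule.subset_span ?_)
  by_cases h0 : m = 0
  · left; rw [h0]; rfl
  · right
    obtain ⟨i, hi⟩ := Finsupp.support_nonempty_iff.2 h0
    refine ⟨i, ?_⟩
    have h3 : m = Finsupp.single i 1 := by
      have hi' : m i ≠ 0 := Finsupp.mem_support_iff.1 hi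
      rw [Finsupp.sum_fintype _ _ (by simp)] at h1
      ext j
      have h4 := Finset.add_sum_erase Finset.univ m (Finset.mem_univ i)
      by_cases hj : j = i
      · subst hj; simp; omega
      · have h5 : m j ≤ ∑ x ∈ Finset.univ.erase i, m x :=
          Finset.single_le_sum (f := m) (fun _ _ => Nat.zero_le _)
            (Finset.mem_erase.2 ⟨hj, Finset.mem_univ j⟩)
        rw [Finsupp.single_eq_of_ne hj]
        omega
    rw [h3]; rfl

theorem span_lin {K : Type*} [Field K] {ν : ℕ} (g : MvPolynomial (Fin ν) K)
    (hg : g ∈ Submodule.span K (insert 1 (Set.range (X : Fin ν → MvPolynomial (Fin ν) K)))) :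
    g.totalDegree ≤ 1 := by
  induction hg using Submodule.span_induction with
  | mem g hg =>
    rcases hg with rfl | ⟨i, rfl⟩
    · simp
    · simp
  | zero => simp
  | add a b _ _ ha hb => exact (totalDegree_add _ _).trans (max_le ha hb)
  | smul r a _ ha => exact (totalDegree_smul_le _ _).trans ha

/-- points of the quotient ring versus points of the variety -/
noncomputable def ptMap {K : Type*} [Field K] {ν : ℕ} (I : Ideal (MvPolynomial (Fin ν) K))
    (p : (MvPolynomial (Fin ν) K ⧸ I) →ₐ[K] K) : Fin ν → K :=
  fun i => p (Ideal.Quotient.mk I (X i))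

theorem ptMap_eval {K : Type*} [Field K] {ν : ℕ} (I : Ideal (MvPolynomial (Fin ν) K))
    (p : (MvPolynomial (Fin ν) K ⧸ I) →ₐ[K] K) (f : MvPolynomial (Fin ν) K) :
    eval (ptMap I p) f = p (Ideal.Quotient.mk I f) := by
  have : aeval (ptMap I p) = p.comp (Ideal.Quotient.mkₐ K I) := by
    ext i
    simp [ptMap]
  have h := AlgHom.congr_fun this f
  rw [aeval_eq_eval] at h
  exact h

theorem ptMap_inj {K : Type*} [Field K] {ν : ℕ} (I : Ideal (MvPolynomial (Fin ν) K)) :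
    Function.Injective (ptMap I) := by
  intro p q h
  apply AlgHom.ext
  intro x
  obtain ⟨f, rfl⟩ := Ideal.Quotient.mk_surjective x
  rw [← ptMap_eval, ← ptMap_eval, h]

theorem ptMap_image {K : Type*} [Field K] {ν : ℕ} (I : Ideal (MvPolynomial (Fin ν) K))
    (L : Finset (MvPolynomial (Fin ν) K)) :
    {x : Fin ν → K | (∀ f ∈ I, eval x f = 0) ∧ ∀ f ∈ L, eval x f = 0} =
      ptMap I '' {p | ∀ f ∈ L, p (Ideal.Quotient.mk I f) = 0} := by
  ext x
  constructor
  · rintro ⟨h1, h2⟩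
    let p : (MvPolynomial (Fin ν) K ⧸ I) →ₐ[K] K :=
      Ideal.Quotient.liftₐ I (aeval x) (fun f hf => by rw [aeval_eq_eval]; exact h1 f hf)
    have hp : ∀ f, p (Ideal.Quotient.mk I f) = eval x f := by
      intro f
      have : p (Ideal.Quotient.mk I f) = aeval x f := Ideal.Quotient.liftₐ_apply _ _ _ _
      rw [this, aeval_eq_eval]
    refine ⟨p, fun f hf => by rw [hp]; exact h2 f hf, ?_⟩
    funext i
    change p _ = _
    rw [hp, eval_X]
  · rintro ⟨p, hp, rfl⟩
    refine ⟨fun f hf => ?_, fun f hf => ?_⟩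
    · rw [ptMap_eval, Ideal.Quotient.eq_zero_iff_mem.2 hf, map_zero]
    · rw [ptMap_eval]; exact hp f hf

/-- the set of cardinalities in the definition of the degree -/
def degSet {K : Type*} [Field K] {ν : ℕ} (I : Ideal (MvPolynomial (Fin ν) K)) : Set ℕ :=
  {c : ℕ | ∃ L : Finset (MvPolynomial (Fin ν) K),
    (∀ f ∈ L, f.totalDegree ≤ 1) ∧
    {x : Fin ν → K | (∀ f ∈ I, eval x f = 0) ∧ ∀ f ∈ L, eval x f = 0}.Finite ∧
    {x : Fin ν → K | (∀ f ∈ I, eval x f = 0) ∧ ∀ f ∈ L, eval x f = 0}.ncard = c}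

theorem mem_degSet {K : Type*} [Field K] {ν : ℕ} (I : Ideal (MvPolynomial (Fin ν) K)) (c : ℕ) :
    c ∈ degSet I ↔ ∃ L : Finset (MvPolynomial (Fin ν) K), (∀ f ∈ L, f.totalDegree ≤ 1) ∧
      {p : (MvPolynomial (Fin ν) K ⧸ I) →ₐ[K] K | ∀ f ∈ L, p (Ideal.Quotient.mk I f) = 0}.Finite ∧
      {p : (MvPolynomial (Fin ν) K ⧸ I) →ₐ[K] K |
        ∀ f ∈ L, p (Ideal.Quotient.mk I f) = 0}.ncard = c := by
  refine exists_congr fun L => and_congr_right fun _ => ?_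
  rw [ptMap_image, Set.finite_image_iff (ptMap_inj I).injOn,
    Set.ncard_image_of_injective _ (ptMap_inj I)]

theorem degSet_main {K : Type*} [Field K] [IsAlgClosed K] {n : ℕ}
    (I : Ideal (MvPolynomial (Fin n) K)) (hI : I.IsPrime)
    (k : ℕ) (hk : k ≤ n) :
    ∃ T : ℕ, ∀ c ∈ degSet (Ideal.comap (MvPolynomial.rename (Fin.castLE hk)).toRingHom I),
      c ≤ T ∧ (c = 0 ∨ ∃ c' ∈ degSet I, c ≤ c') := by
  classical
  set Ik := Ideal.comap (MvPolynomial.rename (R := K) (Fin.castLE hk)).toRingHom I with hIk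
  have hIkp : Ik.IsPrime := Ideal.comap_isPrime _ _
  let g : (MvPolynomial (Fin k) K ⧸ Ik) →ₐ[K] (MvPolynomial (Fin n) K ⧸ I) :=
    Ideal.quotientMapₐ I (MvPolynomial.rename (Fin.castLE hk)) le_rfl
  have hg : Function.Injective g := Ideal.quotientMap_injective' (H := le_rfl) le_rfl
  let := g.toRingHom.toAlgebra
  have : IsScalarTower K (MvPolynomial (Fin k) K ⧸ Ik) (MvPolynomial (Fin n) K ⧸ I) :=
    IsScalarTower.of_algebraMap_eq fun r => (g.commutes r).symm
  have : FaithfulSMul (MvPolynomial (Fin k) K ⧸ Ik) (MvPolynomial (Fin n) K ⧸ I) :=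
    (faithfulSMul_iff_algebraMap_injective _ _).2 hg
  let x : Fin n → (MvPolynomial (Fin n) K ⧸ I) := fun i => Ideal.Quotient.mk I (X i)
  have hx : Algebra.adjoin K (Set.range x) = ⊤ := by
    have h1 : Set.range x = Ideal.Quotient.mkₐ K I '' Set.range X := by
      rw [← Set.range_comp]; rfl
    rw [h1, ← AlgHom.map_adjoin, adjoin_range_X, Algebra.map_top, AlgHom.range_eq_top]
    exact Ideal.Quotient.mkₐ_surjective K I
  have hspan : Submodule.span K (insert 1 (Set.range x)) =
      (Submodule.span K (insert 1 (Set.range (X : Fin n → MvPolynomial (Fin n) K)))).map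
        (Ideal.Quotient.mkₐ K I).toLinearMap := by
    rw [Submodule.map_span, Set.image_insert_eq, ← Set.range_comp]
    congr 2
  obtain ⟨T, hT⟩ := lem_N (K := K) (B := MvPolynomial (Fin k) K ⧸ Ik) x hx
  refine ⟨T, fun c hc => ?_⟩
  obtain ⟨L, hL1, hLf, hLc⟩ := (mem_degSet _ _).1 hc
  by_cases hc0 : c = 0
  · exact ⟨by omega, Or.inl hc0⟩
  let f : Fin L.card → (MvPolynomial (Fin k) K ⧸ Ik) := fun i =>
    Ideal.Quotient.mk Ik (L.equivFin.symm i)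
  have hset : {p : (MvPolynomial (Fin k) K ⧸ Ik) →ₐ[K] K | ∀ i, p (f i) = 0} =
      {p | ∀ f ∈ L, p (Ideal.Quotient.mk Ik f) = 0} := by
    ext p
    constructor
    · intro h q hq
      have := h (L.equivFin ⟨q, hq⟩)
      simpa [f] using this
    · intro h i
      exact h _ (L.equivFin.symm i).2
  have hN := hT f
  rw [hset] at hN
  obtain ⟨h1, ι, hι, l, hl, a, hfin, hcard⟩ := hN hLf (by
    intro i
    rw [hspan]
    refine ⟨rename (Fin.castLE hk) (L.equivFin.symm i : MvPolynomial (Fin k) K), ?_, rfl⟩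
    exact lin_span _ ((totalDegree_rename_le _ _).trans (hL1 _ (L.equivFin.symm i).2)))
    (by
      rw [← Set.ncard_pos hLf, hLc]
      omega)
  rw [hLc] at h1 hcard
  refine ⟨h1, Or.inr ⟨_, ?_, hcard⟩⟩
  rw [mem_degSet]
  have hlift : ∀ i, ∃ q : MvPolynomial (Fin n) K, q.totalDegree ≤ 1 ∧ Ideal.Quotient.mk I q = l i := by
    intro i
    have := hl i
    rw [hspan] at this
    obtain ⟨q, hq, hql⟩ := this
    exact ⟨q, span_lin q hq, hql⟩
  choose q hq1 hq using hlift
  have hset2 : {p : (MvPolynomial (Fin n) K ⧸ I) →ₐ[K] K | ∀ i, p (l i) = a i} =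
      {p | ∀ f ∈ Finset.univ.image (fun i => q i - C (a i)), p (Ideal.Quotient.mk I f) = 0} := by
    ext p
    simp only [Set.mem_ofPred_eq, Finset.mem_image, Finset.mem_univ, true_and,
      forall_exists_index, forall_apply_eq_imp_iff]
    refine forall_congr' fun i => ?_
    have : p (Ideal.Quotient.mk I (C (a i))) = a i := p.commutes (a i)
    rw [map_sub, map_sub, hq, this, sub_eq_zero]
  refine ⟨Finset.univ.image (fun i => q i - C (a i)), ?_, ?_, ?_⟩
  · intro f hf
    obtain ⟨i, -, rfl⟩ := Finset.mem_image.1 hf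
    refine (totalDegree_sub _ _).trans (max_le (hq1 i) ?_)
    simp
  · rw [← hset2]; exact hfin
  · rw [← hset2]

/-- for a prime ideal `I ⊆ K[x₁,…,xₙ]` and its elimination ideal
`I_k = I ∩ K[x₁,…,x_k]`, one has `deg(I_k) ≤ deg(I)`. -/
theorem stmt_17 {K : Type*} [Field K] [IsAlgClosed K] {n : ℕ}
    (I : Ideal (MvPolynomial (Fin n) K)) (hI : I.IsPrime)
    (k : ℕ) (hk : k ≤ n) :
    affineDegree
        (Ideal.comap (MvPolynomial.rename (Fin.castLE hk)).toRingHom I) ≤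
      affineDegree I := by
  change sSup (degSet _) ≤ sSup (degSet I)
  obtain ⟨T, hT⟩ := degSet_main I hI n le_rfl
  have hid : Ideal.comap (MvPolynomial.rename (R := K) (Fin.castLE (le_refl n))).toRingHom I = I := by
    ext f
    rw [Ideal.mem_comap]
    have : (MvPolynomial.rename (R := K) (Fin.castLE (le_refl n))).toRingHom f = f := by
      change MvPolynomial.rename (R := K) (Fin.castLE (le_refl n)) f = f
      have h : Fin.castLE (le_refl n) = id := rfl
      rw [h, rename_id]; rfl
    rw [this]
  rw [hid] at hT
  have hbdd : BddAbove (degSet I) := ⟨T, fun c hc => (hT c hc).1⟩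
  obtain ⟨T', hT'⟩ := degSet_main I hI k hk
  refine csSup_le' fun c hc => ?_
  rcases (hT' c hc).2 with h | ⟨c', hc', h⟩
  · rw [h]; exact Nat.zero_le _
  · exact h.trans (le_csSup hbdd hc')
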